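/- Let K ⊆ V* and K' ⊆ 𝕍 = V × V* be subspaces with K' ∩ V* = {0} and K + K' ⊆ Ann(K + K'). Then K ∩ K' = {0}, and the pairing ⟨,⟩ descends to a well-defined nondegenerate symmetric bilinear form on the quotient 𝕍_K = Ann(K + K')/(K + K'). (First part of Lemma courant:extend, i.e. Lemma 4.3 of [Hu].) -/

import Mathlib

/-- The generalized tangent space `𝕍 = V × V*`. -/
abbrev GV (V : Type*) [AddCommGroup V] [Module ℝ V] := V × Module.Dual ℝ V

variable (V : Type*) [AddCommGroup V] [Module ℝ V] [FiniteDimensional ℝ V]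

/-- The canonical symmetric pairing `⟨(X,ξ),(Y,η)⟩ = (1/2)(η X + ξ Y)` on `𝕍`. -/
noncomputable def pairForm : LinearMap.BilinForm ℝ (GV V) :=
  LinearMap.mk₂ ℝ (fun u v => (1 / 2 : ℝ) * (v.2 u.1 + u.2 v.1))
    (fun u u' v => by simp; ring)
    (fun c u v => by simp; ring)
    (fun u v v' => by simp; ring)
    (fun c u v => by simp; ring)

/-- `V* = {0} × V*` as a subspace of `𝕍`. -/
def VStar : Submodule ℝ (GV V) := LinearMap.range (LinearMap.inr ℝ V (Module.Dual ℝ V))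

variable {V}

/-- The annihilator of a subspace of `𝕍` with respect to the canonical pairing. -/
noncomputable def Ann (S : Submodule ℝ (GV V)) : Submodule ℝ (GV V) where
  carrier := {u : GV V | ∀ s ∈ S, pairForm V u s = 0}
  add_mem' := fun ha hb s hs => by simp [ha s hs, hb s hs]
  zero_mem' := fun s hs => by simp
  smul_mem' := fun c a ha s hs => by simp [ha s hs]

/-- The image in `𝕍` of a subspace `K ⊆ V*`. -/
def ofDual (K : Submodule ℝ (Module.Dual ℝ V)) : Submodule ℝ (GV V) :=
  K.map (LinearMap.inr ℝ V (Module.Dual ℝ V))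

/-- A linear generalized complex structure on `𝕍`. -/
structure IsGenCx (J : GV V →ₗ[ℝ] GV V) : Prop where
  sq : ∀ u, J (J u) = -u
  orth : ∀ u v, pairForm V (J u) (J v) = pairForm V u v

/-- A linear generalized Kähler structure on `𝕍`: two commuting linear generalized
complex structures such that `G = -J₁∘J₂` gives a positive definite form `⟨G·,·⟩`. -/
structure IsGenKahler (J₁ J₂ : GV V →ₗ[ℝ] GV V) : Prop where
  cx1 : IsGenCx J₁
  cx2 : IsGenCx J₂
  comm : ∀ u, J₁ (J₂ u) = J₂ (J₁ u)
  posdef : ∀ u : GV V, u ≠ 0 → 0 < pairForm V (-(J₁ (J₂ u))) u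

omit [FiniteDimensional ℝ V] in
theorem pairForm_apply (u v : GV V) :
    pairForm V u v = (1 / 2 : ℝ) * (v.2 u.1 + u.2 v.1) := rfl

omit [FiniteDimensional ℝ V] in
theorem pairForm_comm (u v : GV V) : pairForm V u v = pairForm V v u := by
  simp only [pairForm_apply, add_comm]

omit [FiniteDimensional ℝ V] in
theorem pairForm_isRefl : (pairForm V).IsRefl :=
  fun u v h => by rw [pairForm_comm, h]

theorem pairForm_nondegenerate : (pairForm V).Nondegenerate := by
  refine (LinearMap.IsRefl.nondegenerate_iff_separatingLeft (B := pairForm V) pairForm_isRefl).2 ?_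
  intro u hu
  refine Prod.ext ((Module.forall_dual_apply_eq_zero_iff ℝ u.1).1 fun φ => ?_)
    (LinearMap.ext fun x => ?_)
  · simpa [pairForm_apply] using hu (0, φ)
  · simpa [pairForm_apply] using hu (x, 0)

omit [FiniteDimensional ℝ V] in
theorem Ann_eq_orthogonal (S : Submodule ℝ (GV V)) : Ann S = (pairForm V).orthogonal S := by
  ext u
  exact forall₂_congr fun s _ => by rw [pairForm_comm]

theorem Ann_Ann (S : Submodule ℝ (GV V)) : Ann (Ann S) = S := by
  rw [Ann_eq_orthogonal, Ann_eq_orthogonal,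
    LinearMap.BilinForm.orthogonal_orthogonal pairForm_nondegenerate pairForm_isRefl]

omit [FiniteDimensional ℝ V] in
theorem ofDual_le_VStar (K : Submodule ℝ (Module.Dual ℝ V)) : ofDual K ≤ VStar V :=
  LinearMap.map_le_range

/-- first part of Lemma courant:extend, Lemma 4.3 of [Hu]: if
`K' ∩ V* = 0` and `K + K' ⊆ Ann(K + K')`, then `K ∩ K' = 0` and `⟨,⟩` descends to
a well-defined nondegenerate (symmetric) form on `𝕍_K = Ann(K + K')/(K + K')`. -/
theorem statement10 {V : Type*} [AddCommGroup V] [Module ℝ V] [FiniteDimensional ℝ V]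
    (K : Submodule ℝ (Module.Dual ℝ V)) (K' : Submodule ℝ (GV V))
    (hKV : K' ⊓ VStar V = ⊥)
    (hIso : ofDual K ⊔ K' ≤ Ann (ofDual K ⊔ K')) :
    let A : Submodule ℝ (GV V) := Ann (ofDual K ⊔ K')
    ofDual K ⊓ K' = ⊥ ∧
    (∀ x ∈ A, ∀ x' ∈ A, ∀ y ∈ A, ∀ y' ∈ A,
      x - x' ∈ ofDual K ⊔ K' → y - y' ∈ ofDual K ⊔ K' →
        pairForm V x y = pairForm V x' y') ∧
    (∀ x ∈ A, (∀ y ∈ A, pairForm V x y = 0) → x ∈ ofDual K ⊔ K') := by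
  refine ⟨?_, fun x _ x' hx' y hy y' _ hxx hyy => ?_, fun x _ h => ?_⟩
  · rw [eq_bot_iff, ← hKV, inf_comm]
    exact inf_le_inf_left K' (ofDual_le_VStar K)
  · have h₁ : pairForm V (x - x') y = 0 := by
      rw [pairForm_comm]
      exact hy _ hxx
    have h₂ : pairForm V x' (y - y') = 0 := hx' _ hyy
    rw [map_sub, LinearMap.sub_apply] at h₁
    rw [map_sub] at h₂
    linarith
  · rw [← Ann_Ann (ofDual K ⊔ K')]
    exact h
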